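/- arXiv:2109.11809 — 15 statements merged into one kernel-verified Lean document; each statement's English description precedes it below -/
import Mathlib

section
/- Let n be an even positive integer and let S be the skew-adjacency matrix of a tournament on n vertices. Then det S = m² for some odd integer m. In particular, det S is odd and positive. -/
open Matrix

/-- A skew-adjacency matrix of a tournament: zero diagonal, skew-symmetric,
off-diagonal entries in `{-1, 1}`. -/
def IsTournament {n : ℕ} (S : Matrix (Fin n) (Fin n) ℤ) : Prop :=
  (∀ i, S i i = 0) ∧ Sᵀ = -S ∧ ∀ i j, i ≠ j → S i j = 1 ∨ S i j = -1

theorem Matrix.isSquare_det_of_transpose_eq_neg {K : Type*} [Field K] (h2 : (2 : K) ≠ 0) (n : ℕ)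
    (A : Matrix (Fin n) (Fin n) K) (hA : Aᵀ = -A) : IsSquare A.det := by
  induction n using Nat.strong_induction_on with
  | _ n ih =>
  have skew : ∀ i j, A j i = -A i j := fun i j => congrFun (congrFun hA i) j
  have diag : ∀ i, A i i = 0 := fun i => by
    have h : 2 * A i i = 0 := by linear_combination skew i i
    exact (mul_eq_zero.mp h).resolve_left h2
  match n with
  | 0 => simp
  | 1 => simp [diag]
  | k + 2 =>
    by_cases hrow : ∀ j, A 0 j = 0
    · rw [det_eq_zero_of_row_eq_zero 0 hrow]
      exact IsSquare.zero
    · push Not at hrow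
      obtain ⟨j, hj⟩ := hrow
      have hj0 : j ≠ 0 := by
        rintro rfl
        exact hj (diag 0)
      let e : Fin 2 ⊕ Fin k ≃ Fin (k + 2) :=
        (finSumFinEquiv.trans (finCongr (add_comm 2 k))).trans (Equiv.swap 1 j)
      have he0 : e (Sum.inl 0) = 0 := by
        change Equiv.swap 1 j 0 = 0
        exact Equiv.swap_apply_of_ne_of_ne (by simp) hj0.symm
      have he1 : e (Sum.inl 1) = j := by
        change Equiv.swap 1 j 1 = j
        exact Equiv.swap_apply_left 1 j
      rw [← det_submatrix_equiv_self e A, ← fromBlocks_toBlocks (A.submatrix e e)]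
      set P := (A.submatrix e e).toBlocks₁₁ with hP
      set B := (A.submatrix e e).toBlocks₁₂ with hB
      set C := (A.submatrix e e).toBlocks₂₁ with hC
      set D := (A.submatrix e e).toBlocks₂₂ with hD
      have hPt : Pᵀ = -P := by ext a b; exact skew _ _
      have hBt : Bᵀ = -C := by ext a b; exact skew _ _
      have hCt : Cᵀ = -B := by ext a b; exact skew _ _
      have hDt : Dᵀ = -D := by ext a b; exact skew _ _
      have hPdet : P.det = A 0 j * A 0 j := by
        rw [det_fin_two]
        simp only [hP, toBlocks₁₁, of_apply, submatrix_apply, he0, he1, diag, skew 0 j]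
        ring
      have hPu : IsUnit P.det := by
        rw [hPdet]
        exact (mul_ne_zero hj hj).isUnit
      have hPinv : (P⁻¹)ᵀ = -P⁻¹ := by
        rw [transpose_nonsing_inv, hPt]
        exact inv_eq_left_inv (by rw [neg_mul_neg, nonsing_inv_mul _ hPu])
      let := P.invertibleOfIsUnitDet hPu
      rw [det_fromBlocks₁₁, invOf_eq_nonsing_inv, hPdet]
      refine (IsSquare.mul_self _).mul (ih k (by omega) _ ?_)
      rw [transpose_sub, transpose_mul, transpose_mul, hPinv, hBt, hCt, hDt]
      simp only [Matrix.mul_neg, Matrix.neg_mul, neg_neg, Matrix.mul_assoc]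
      abel

theorem IsTournament.odd_det {n : ℕ} (hn : Even n) {S : Matrix (Fin n) (Fin n) ℤ}
    (hS : IsTournament S) : Odd S.det := by
  obtain ⟨h0, -, h1⟩ := hS
  let M : Matrix (Fin n) (Fin n) (ZMod 2) := S.map (Int.castRingHom (ZMod 2))
  let J : Matrix (Fin n) (Fin n) (ZMod 2) := of fun _ _ => 1
  have hM : M = J + 1 := by
    ext i j
    by_cases h : i = j
    · subst h
      simp [M, J, h0]
      decide
    · rcases h1 i j h with h' | h' <;> simp [M, J, h', h, one_apply_ne]
  have hJ : J * J = 0 := by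
    ext i j
    simpa [J, mul_apply] using (ZMod.natCast_eq_zero_iff_even).mpr hn
  have hMM : M * M = 1 := by
    have hJJ : J + J = 0 := by
      ext i j
      exact CharTwo.add_self_eq_zero _
    rw [hM, add_mul, mul_add, mul_one, one_mul, hJ, zero_add, ← add_assoc, hJJ, zero_add]
  have hdet : (S.det : ZMod 2) = M.det := (Int.castRingHom (ZMod 2)).map_det S
  rw [← Int.not_even_iff_odd, ← ZMod.intCast_eq_zero_iff_even, hdet]
  intro h
  have := congrArg det hMM
  simp [h] at this

theorem det_tournament_even_is_odd_square {n : ℕ} (hn : Even n) (hpos : 0 < n)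
    (S : Matrix (Fin n) (Fin n) ℤ) (hS : IsTournament S) :
    (∃ m : ℤ, Odd m ∧ S.det = m ^ 2) ∧ Odd S.det ∧ 0 < S.det := by
  have hodd := hS.odd_det hn
  have hsq : IsSquare (S.map (Int.castRingHom ℚ)).det := by
    refine isSquare_det_of_transpose_eq_neg two_ne_zero n _ ?_
    rw [← transpose_map, hS.2.1]
    ext i j
    simp
  have hdet : (S.det : ℚ) = (S.map (Int.castRingHom ℚ)).det := (Int.castRingHom ℚ).map_det S
  rw [← hdet, Rat.isSquare_intCast_iff] at hsq
  obtain ⟨m, hm⟩ := hsq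
  have hm_odd : Odd m := (Int.odd_mul.mp (hm ▸ hodd)).1
  have hm0 : m ≠ 0 := by
    rintro rfl
    simp at hm_odd
  exact ⟨⟨m, hm_odd, by rw [hm, sq]⟩, hodd, hm ▸ mul_self_pos.mpr hm0⟩
end

section
/- Let M be a real skew-symmetric matrix written in block form M = [[A, B], [−Bᵀ, D]], where A and D are square (necessarily skew-symmetric) blocks. If A is invertible and B has rank 1, then det M = det A · det D. -/
open Matrix

/-- A matrix of rank at most one over a field is an outer product. -/
theorem exists_eq_vecMulVec_of_rank_le_one {K m n : Type*} [Field K] [Finite m] [Fintype n]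
    (B : Matrix m n K) (hB : B.rank ≤ 1) : ∃ (u : m → K) (v : n → K), B = vecMulVec u v := by
  classical
  obtain ⟨u, hu⟩ := ((Submodule.finrank_le_one_iff_isPrincipal
    (LinearMap.range B.mulVecLin)).1 hB).principal
  have hcol (j : n) : ∃ c : K, c • u = B.col j := by
    rw [← Submodule.mem_span_singleton, ← hu]
    exact ⟨Pi.single j 1, by simp⟩
  choose v hv using hcol
  refine ⟨u, v, ?_⟩
  ext i j
  simpa [vecMulVec_apply, mul_comm] using (congrFun (hv j) i).symm

/-- The quadratic form of a skew-symmetric matrix vanishes. -/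
theorem dotProduct_mulVec_self_eq_zero_of_transpose_eq_neg {R n : Type*} [CommRing R]
    [IsAddTorsionFree R] [Fintype n] {S : Matrix n n R} (hS : Sᵀ = -S) (u : n → R) :
    u ⬝ᵥ S *ᵥ u = 0 := by
  have h : u ⬝ᵥ S *ᵥ u = -(u ⬝ᵥ S *ᵥ u) := by
    conv_lhs => rw [dotProduct_mulVec, ← mulVec_transpose, hS, dotProduct_comm]
    rw [neg_mulVec, dotProduct_neg]
  exact self_eq_neg.1 h

theorem det_skew_block_rank_one {p q : ℕ}
    (A : Matrix (Fin p) (Fin p) ℝ) (B : Matrix (Fin p) (Fin q) ℝ)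
    (D : Matrix (Fin q) (Fin q) ℝ)
    (hskew : (Matrix.fromBlocks A B (-Bᵀ) D)ᵀ = -(Matrix.fromBlocks A B (-Bᵀ) D))
    (hA : IsUnit A.det) (hB : B.rank = 1) :
    (Matrix.fromBlocks A B (-Bᵀ) D).det = A.det * D.det := by
  rw [fromBlocks_transpose, fromBlocks_neg, fromBlocks_inj] at hskew
  have hinv : A⁻¹ᵀ = -A⁻¹ := by
    rw [transpose_nonsing_inv, hskew.1]
    exact inv_eq_left_inv (by simp [nonsing_inv_mul A hA])
  obtain ⟨u, v, rfl⟩ := exists_eq_vecMulVec_of_rank_le_one B hB.le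
  have hzero : (vecMulVec u v)ᵀ * A⁻¹ * vecMulVec u v = 0 := by
    rw [transpose_vecMulVec, Matrix.mul_assoc, mul_vecMulVec, vecMulVec_mul_vecMulVec,
      dotProduct_mulVec_self_eq_zero_of_transpose_eq_neg hinv, zero_smul, vecMulVec_zero]
  let _ := invertibleOfIsUnitDet A hA
  rw [det_fromBlocks₁₁, invOf_eq_nonsing_inv, Matrix.neg_mul, Matrix.neg_mul, hzero, neg_zero,
    sub_zero]
end

section
/- Let S₁ and S₂ be skew-adjacency matrices of tournaments on p and q vertices respectively, with p and q both even. Then the determinant of the join satisfies det [[S₁, J], [−Jᵀ, S₂]] = det S₁ · det S₂, where J is the p×q all-ones matrix. -/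
open Matrix

/-- A tournament on an even number of vertices has nonzero skew-adjacency determinant:
modulo 2 the matrix is `J + I`, which squares to the identity. -/
theorem IsTournament.det_ne_zero {n : ℕ} (hn : Even n) {S : Matrix (Fin n) (Fin n) ℤ}
    (hS : IsTournament S) : S.det ≠ 0 := by
  intro h
  have hmod : S.map (Int.castRingHom (ZMod 2)) = (Matrix.of fun _ _ => 1) + 1 := by
    ext i j
    by_cases hij : i = j
    · subst hij
      simp only [Matrix.map_apply, hS.1 i, Matrix.add_apply, Matrix.of_apply, Matrix.one_apply_eq,
        map_zero]
      decide
    · rcases hS.2.2 i j hij with h | h <;>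
        simp [h, Matrix.one_apply_ne hij]
  have hJ : (Matrix.of fun _ _ => 1 : Matrix (Fin n) (Fin n) (ZMod 2)) *
      (Matrix.of fun _ _ => 1) = 0 := by
    ext i j
    simp [Matrix.mul_apply, (ZMod.natCast_eq_zero_iff_even).2 hn]
  have hsq : S.map (Int.castRingHom (ZMod 2)) * S.map (Int.castRingHom (ZMod 2)) = 1 := by
    rw [hmod, add_mul, mul_add, hJ]
    ext i j
    simp only [one_mul, mul_one, Matrix.add_apply, Matrix.zero_apply, Matrix.of_apply]
    rw [zero_add, ← add_assoc, CharTwo.add_self_eq_zero, zero_add]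
  have hdet := congrArg Matrix.det hsq
  have hmap : (S.map (Int.castRingHom (ZMod 2))).det = 0 := by
    rw [← RingHom.mapMatrix_apply, ← RingHom.map_det, h, map_zero]
  rw [Matrix.det_mul, hmap, Matrix.det_one] at hdet
  simp at hdet

/-- The entries of a skew-symmetric rational matrix sum to zero. -/
theorem sum_sum_eq_zero_of_transpose_eq_neg {n : Type*} [Fintype n] {A : Matrix n n ℚ}
    (hA : Aᵀ = -A) : ∑ i, ∑ j, A i j = 0 := by
  have h : ∑ i, ∑ j, A i j = -∑ i, ∑ j, A i j := by
    calc ∑ i, ∑ j, A i j = ∑ i, ∑ j, A j i := Finset.sum_comm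
      _ = ∑ i, ∑ j, -A i j :=
        Finset.sum_congr rfl fun i _ => Finset.sum_congr rfl fun j _ => congrFun₂ hA i j
      _ = -∑ i, ∑ j, A i j := by simp only [Finset.sum_neg_distrib]
  linarith

/-- Joining an invertible skew-symmetric matrix with any square matrix multiplies determinants. -/
theorem det_fromBlocks_one_neg_one_of_skew {m n : Type*} [Fintype m] [DecidableEq m] [Fintype n]
    [DecidableEq n] {A : Matrix m m ℚ} (hA : Aᵀ = -A) (hdet : A.det ≠ 0) (D : Matrix n n ℚ) :
    (Matrix.fromBlocks A (Matrix.of fun _ _ => 1) (Matrix.of fun _ _ => -1) D).det =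
      A.det * D.det := by
  have hunit : IsUnit A.det := isUnit_iff_ne_zero.2 hdet
  let := Matrix.invertibleOfIsUnitDet A hunit
  have hinv : (A⁻¹)ᵀ = -A⁻¹ := by
    rw [Matrix.transpose_nonsing_inv, hA]
    exact Matrix.inv_eq_left_inv (by rw [neg_mul_neg, Matrix.nonsing_inv_mul A hunit])
  have hzero : (Matrix.of fun _ _ => -1 : Matrix n m ℚ) * A⁻¹ *
      (Matrix.of fun _ _ => 1 : Matrix m n ℚ) = 0 := by
    ext i j
    have h : ∑ k, ∑ l, A⁻¹ l k = 0 :=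
      Finset.sum_comm.trans (sum_sum_eq_zero_of_transpose_eq_neg hinv)
    simp [Matrix.mul_apply, h]
  rw [Matrix.det_fromBlocks₁₁, Matrix.invOf_eq_nonsing_inv, hzero, sub_zero]

theorem det_join_even {p q : ℕ} (hp : Even p) (hq : Even q)
    (S₁ : Matrix (Fin p) (Fin p) ℤ) (S₂ : Matrix (Fin q) (Fin q) ℤ)
    (hS₁ : IsTournament S₁) (hS₂ : IsTournament S₂) :
    (Matrix.fromBlocks S₁ (Matrix.of fun _ _ => (1 : ℤ))
      (Matrix.of fun _ _ => (-1 : ℤ)) S₂).det = S₁.det * S₂.det := by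
  have hdet : (S₁.map (Int.castRingHom ℚ)).det = S₁.det := by
    rw [← RingHom.mapMatrix_apply, ← RingHom.map_det, eq_intCast]
  have hskew : (S₁.map (Int.castRingHom ℚ))ᵀ = -S₁.map (Int.castRingHom ℚ) := by
    rw [← Matrix.transpose_map, hS₁.2.1]
    ext i j
    simp
  have h := det_fromBlocks_one_neg_one_of_skew hskew
    (by rw [hdet]; exact_mod_cast hS₁.det_ne_zero hp) (S₂.map (Int.castRingHom ℚ))
  apply (Int.castRingHom ℚ).injective_int
  rw [map_mul, RingHom.map_det, RingHom.map_det, RingHom.map_det]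
  simp only [RingHom.mapMatrix_apply]
  rw [← h, Matrix.fromBlocks_map]
  congr 2
end

section
/- Let S₁ and S₂ be skew-adjacency matrices of tournaments on p and q vertices respectively, with p and q both odd. Then det [[S₁, J], [−Jᵀ, S₂]] = det S₁⁺ · det S₂⁺, where J is the p×q all-ones matrix and S⁺ denotes the matrix S bordered by a final column of all ones and a final row of all minus-ones (with 0 in the corner). -/
open Matrix

/-- `S⁺` : the skew-adjacency matrix of `T⁺`, obtained from `S` by appending a
last column of all ones and a last row of all minus-ones, with corner entry `0`. -/
def plusOne {n : ℕ} (S : Matrix (Fin n) (Fin n) ℤ) : Matrix (Fin (n + 1)) (Fin (n + 1)) ℤ :=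
  Matrix.of fun i j =>
    if hi : (i : ℕ) < n then
      (if hj : (j : ℕ) < n then S ⟨i, hi⟩ ⟨j, hj⟩ else 1)
    else (if (j : ℕ) < n then -1 else 0)

/-- The all-ones matrix. -/
def allOnes (m n R : Type*) [One R] : Matrix m n R := Matrix.of fun _ _ => 1

/-- The matrix all of whose rows equal `v`. -/
def constRows (m : Type*) {n R : Type*} (v : n → R) : Matrix m n R := Matrix.of fun _ j => v j

lemma constRows_mul {m n l R : Type*} [Fintype n] [NonUnitalNonAssocSemiring R]
    (v : n → R) (A : Matrix n l R) : constRows m v * A = constRows m (v ᵥ* A) := by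
  ext i j
  simp [constRows, Matrix.mul_apply, Matrix.vecMul, dotProduct]

lemma vecMul_allOnes {m n R : Type*} [Fintype m] [NonAssocSemiring R] (v : m → R) :
    v ᵥ* allOnes m n R = fun _ => ∑ i, v i := by
  ext j
  simp [allOnes, Matrix.vecMul, dotProduct]

lemma constRows_mul_allOnes {l m n R : Type*} [Fintype m] [NonAssocSemiring R] {v : m → R}
    (hv : ∑ i, v i = 1) : constRows l v * allOnes m n R = allOnes l n R := by
  rw [constRows_mul, vecMul_allOnes, hv]
  rfl

lemma map_allOnes {m n R S : Type*} [NonAssocSemiring R] [NonAssocSemiring S] (f : R →+* S) :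
    (allOnes m n R).map f = allOnes m n S := by
  ext
  simp [allOnes]

lemma map_neg_allOnes {m n R S : Type*} [NonAssocRing R] [NonAssocRing S] (f : R →+* S) :
    (-allOnes m n R).map f = -allOnes m n S := by
  ext
  simp [allOnes]

section Field

variable {m n K : Type*} [Fintype m] [Fintype n] [DecidableEq m] [DecidableEq n] [Field K]

/-- A singular matrix either has a left kernel vector with coordinate sum `0`, or one with
coordinate sum `1`. -/
lemma exists_vecMul_eq_zero_sum {A : Matrix m m K} (hA : A.det = 0) :
    (∃ v ≠ 0, v ᵥ* A = 0 ∧ ∑ i, v i = 0) ∨ ∃ v, v ᵥ* A = 0 ∧ ∑ i, v i = 1 := by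
  obtain ⟨v, hv, hvA⟩ := Matrix.exists_vecMul_eq_zero_iff.mpr hA
  by_cases hs : ∑ i, v i = 0
  · exact Or.inl ⟨v, hv, hvA, hs⟩
  · refine Or.inr ⟨(∑ i, v i)⁻¹ • v, by rw [Matrix.smul_vecMul, hvA, smul_zero], ?_⟩
    simp [← Finset.mul_sum, inv_mul_cancel₀ hs]

lemma det_add_allOnes_eq_zero {A : Matrix m m K} {v : m → K} (hv : v ≠ 0)
    (hvA : v ᵥ* A = 0) (hs : ∑ i, v i = 0) : (A + allOnes m m K).det = 0 := by
  refine Matrix.exists_vecMul_eq_zero_iff.mp ⟨v, hv, ?_⟩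
  rw [Matrix.vecMul_add, hvA, vecMul_allOnes, hs, zero_add]
  rfl

/-- The determinant of the join of two singular matrices. -/
lemma det_fromBlocks_allOnes {A : Matrix m m K} {D : Matrix n n K}
    (hA : A.det = 0) (hD : D.det = 0) :
    (Matrix.fromBlocks A (allOnes m n K) (-allOnes n m K) D).det =
      (A + allOnes m m K).det * (D + allOnes n n K).det := by
  rcases exists_vecMul_eq_zero_sum hA with ⟨k, hk, hkA, hks⟩ | ⟨k, hkA, hks⟩
  · rw [det_add_allOnes_eq_zero hk hkA hks, zero_mul]
    refine Matrix.exists_vecMul_eq_zero_iff.mp ⟨Sum.elim k 0, ?_, ?_⟩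
    · exact fun h => hk (funext fun i => congrFun h (Sum.inl i))
    · rw [Matrix.vecMul_fromBlocks]
      ext (i | i) <;> simp [hkA, vecMul_allOnes, hks]
  rcases exists_vecMul_eq_zero_sum hD with ⟨l, hl, hlD, hls⟩ | ⟨l, hlD, hls⟩
  · rw [det_add_allOnes_eq_zero hl hlD hls, mul_zero]
    refine Matrix.exists_vecMul_eq_zero_iff.mp ⟨Sum.elim 0 l, ?_, ?_⟩
    · exact fun h => hl (funext fun i => congrFun h (Sum.inr i))
    · rw [Matrix.vecMul_fromBlocks]
      ext (i | i) <;> simp [hlD, vecMul_allOnes, hls, Matrix.vecMul_neg]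
  have hk0 : constRows n k * A = 0 := by rw [constRows_mul, hkA]; rfl
  have hl0 : constRows m l * D = 0 := by rw [constRows_mul, hlD]; rfl
  have key : Matrix.fromBlocks 1 (-constRows m l) 0 1 *
      (Matrix.fromBlocks 1 0 (constRows n k) 1 *
        Matrix.fromBlocks A (allOnes m n K) (-allOnes n m K) D) =
      Matrix.fromBlocks (A + allOnes m m K) 0 (-allOnes n m K) (D + allOnes n n K) := by
    simp [Matrix.fromBlocks_multiply, Matrix.mul_add, hk0, hl0, constRows_mul_allOnes hks,
      constRows_mul_allOnes hls, add_comm]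
  have h := congrArg Matrix.det key
  simpa only [Matrix.det_mul, Matrix.det_fromBlocks_zero₂₁, Matrix.det_fromBlocks_zero₁₂,
    Matrix.det_one, one_mul] using h

end Field

/-- Integer version of `det_fromBlocks_allOnes`. -/
lemma det_fromBlocks_allOnes_int {m n : Type*} [Fintype m] [Fintype n] [DecidableEq m]
    [DecidableEq n] {A : Matrix m m ℤ} {D : Matrix n n ℤ} (hA : A.det = 0) (hD : D.det = 0) :
    (Matrix.fromBlocks A (allOnes m n ℤ) (-allOnes n m ℤ) D).det =
      (A + allOnes m m ℤ).det * (D + allOnes n n ℤ).det := by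
  have h := det_fromBlocks_allOnes (A := A.map (Int.castRingHom ℚ))
    (D := D.map (Int.castRingHom ℚ))
    (by rw [← RingHom.mapMatrix_apply, ← RingHom.map_det, hA, map_zero])
    (by rw [← RingHom.mapMatrix_apply, ← RingHom.map_det, hD, map_zero])
  apply (Int.castRingHom ℚ).injective_int
  rw [map_mul, RingHom.map_det, RingHom.map_det, RingHom.map_det]
  simpa only [map_add, RingHom.mapMatrix_apply, Matrix.fromBlocks_map, map_neg_allOnes,
    map_allOnes] using h

lemma det_eq_zero_of_transpose_eq_neg {n : ℕ} (hn : Odd n) {S : Matrix (Fin n) (Fin n) ℤ}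
    (hS : Sᵀ = -S) : S.det = 0 := by
  have h := congrArg Matrix.det hS
  rw [Matrix.det_transpose, Matrix.det_neg, Fintype.card_fin, hn.neg_one_pow] at h
  lia

lemma det_plusOne {n : ℕ} {S : Matrix (Fin n) (Fin n) ℤ} (hS : S.det = 0) :
    (plusOne S).det = (S + allOnes (Fin n) (Fin n) ℤ).det := by
  have h : (plusOne S).submatrix finSumFinEquiv finSumFinEquiv =
      Matrix.fromBlocks S (allOnes (Fin n) (Fin 1) ℤ) (-allOnes (Fin 1) (Fin n) ℤ) 0 := by
    ext (i | i) (j | j) <;> simp [plusOne, allOnes]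
  rw [← Matrix.det_submatrix_equiv_self finSumFinEquiv, h,
    det_fromBlocks_allOnes_int hS (by simp)]
  simp [allOnes]

theorem det_join_odd {p q : ℕ} (hp : Odd p) (hq : Odd q)
    (S₁ : Matrix (Fin p) (Fin p) ℤ) (S₂ : Matrix (Fin q) (Fin q) ℤ)
    (hS₁ : IsTournament S₁) (hS₂ : IsTournament S₂) :
    (Matrix.fromBlocks S₁ (Matrix.of fun _ _ => (1 : ℤ))
      (Matrix.of fun _ _ => (-1 : ℤ)) S₂).det = (plusOne S₁).det * (plusOne S₂).det := by
  have h₁ := det_eq_zero_of_transpose_eq_neg hp hS₁.2.1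
  have h₂ := det_eq_zero_of_transpose_eq_neg hq hS₂.2.1
  rw [det_plusOne h₁, det_plusOne h₂]
  exact det_fromBlocks_allOnes_int h₁ h₂
end

section
/- Let S₁ and S₂ be skew-adjacency matrices of tournaments on p and q vertices respectively, with p and q both even. Then the join has determinant 1, i.e. det [[S₁, J], [−Jᵀ, S₂]] = 1, if and only if det S₁ = 1 and det S₂ = 1. -/
open Matrix

theorem Matrix.dotProduct_mulVec_self_of_transpose_eq_neg {ι : Type*} [Fintype ι]
    {A : Matrix ι ι ℝ} (hA : Aᵀ = -A) (v : ι → ℝ) : v ⬝ᵥ A *ᵥ v = 0 := by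
  have h : v ⬝ᵥ A *ᵥ v = -(v ⬝ᵥ A *ᵥ v) := by
    conv_lhs => rw [dotProduct_mulVec, ← mulVec_transpose, hA, dotProduct_comm]
    rw [neg_mulVec, dotProduct_neg]
  linarith

/-- A real skew-symmetric matrix has nonnegative determinant: otherwise, some matrix on the segment
joining it to the identity would be singular. -/
theorem Matrix.det_nonneg_of_transpose_eq_neg {ι : Type*} [Fintype ι] [DecidableEq ι]
    {A : Matrix ι ι ℝ} (hA : Aᵀ = -A) : 0 ≤ A.det := by
  by_contra! h
  let f : ℝ → ℝ := fun t => ((1 - t) • (1 : Matrix ι ι ℝ) + t • A).det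
  have hf : Continuous f := by
    apply Continuous.matrix_det
    fun_prop
  have h0 : f 0 = 1 := by simp [f]
  have h1 : f 1 = A.det := by simp [f]
  obtain ⟨t, ht, hft⟩ := intermediate_value_Icc' zero_le_one hf.continuousOn
    (show (0 : ℝ) ∈ Set.Icc (f 1) (f 0) by rw [h0, h1]; exact ⟨h.le, zero_le_one⟩)
  obtain ⟨v, hv, hv0⟩ := Matrix.exists_mulVec_eq_zero_iff.mpr hft
  have hvt : (1 - t) * (v ⬝ᵥ v) = 0 := by
    have := congrArg (v ⬝ᵥ ·) hv0
    simpa [add_mulVec, smul_mulVec, dotProduct_mulVec_self_of_transpose_eq_neg hA] using this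
  rcases mul_eq_zero.mp hvt with ht1 | hvv
  · obtain rfl : t = 1 := by linarith
    linarith
  · exact hv (dotProduct_self_eq_zero.mp hvv)

/-- If a block matrix has an invertible skew-symmetric upper left block and off-diagonal blocks with
constant entries `1` and `-1`, then its determinant is the product of those of its diagonal blocks. -/
theorem Matrix.det_fromBlocks_one_neg_one {ι κ : Type*} [Fintype ι] [DecidableEq ι]
    [Fintype κ] [DecidableEq κ] {A : Matrix ι ι ℝ} (hA : Aᵀ = -A) (hdet : A.det ≠ 0)
    (B : Matrix κ κ ℝ) :
    (fromBlocks A (of fun _ _ => 1) (of fun _ _ => -1) B).det = A.det * B.det := by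
  let := A.invertibleOfIsUnitDet hdet.isUnit
  have hinv : (A⁻¹)ᵀ = -A⁻¹ := by
    rw [transpose_nonsing_inv, hA]
    exact inv_eq_right_inv (by simp [mul_nonsing_inv A hdet.isUnit])
  have hzero : (of fun _ _ => -1 : Matrix κ ι ℝ) * ⅟A * (of fun _ _ => 1 : Matrix ι κ ℝ) = 0 := by
    ext i j
    have h := dotProduct_mulVec_self_of_transpose_eq_neg hinv (fun _ => 1)
    rw [dotProduct_mulVec] at h
    simpa [mul_apply, dotProduct, vecMul, Finset.sum_neg_distrib] using h
  rw [det_fromBlocks₁₁, hzero, sub_zero]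

theorem join_unimodular_iff_even {p q : ℕ} (hp : Even p) (hq : Even q)
    (S₁ : Matrix (Fin p) (Fin p) ℤ) (S₂ : Matrix (Fin q) (Fin q) ℤ)
    (hS₁ : IsTournament S₁) (hS₂ : IsTournament S₂) :
    (Matrix.fromBlocks S₁ (Matrix.of fun _ _ => (1 : ℤ))
      (Matrix.of fun _ _ => (-1 : ℤ)) S₂).det = 1 ↔ S₁.det = 1 ∧ S₂.det = 1 := by
  have skew {n : ℕ} {S : Matrix (Fin n) (Fin n) ℤ} (hS : IsTournament S) :
      (S.map (Int.cast : ℤ → ℝ))ᵀ = -S.map (Int.cast : ℤ → ℝ) := by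
    rw [← transpose_map, hS.2.1]
    ext i j
    simp
  have nonneg {n : ℕ} {S : Matrix (Fin n) (Fin n) ℤ} (hS : IsTournament S) : 0 ≤ S.det := by
    have h := det_nonneg_of_transpose_eq_neg (skew hS)
    rw [← Int.cast_det] at h
    exact_mod_cast h
  have hjoin : (Matrix.fromBlocks S₁ (Matrix.of fun _ _ => (1 : ℤ))
      (Matrix.of fun _ _ => (-1 : ℤ)) S₂).det = S₁.det * S₂.det := by
    have hdet : (S₁.map (Int.cast : ℤ → ℝ)).det ≠ 0 := by
      rw [← Int.cast_det]
      exact_mod_cast hS₁.det_ne_zero hp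
    have h := det_fromBlocks_one_neg_one (skew hS₁) hdet (S₂.map (Int.cast : ℤ → ℝ))
    rw [← Int.cast_det, ← Int.cast_det] at h
    apply Int.cast_injective (α := ℝ)
    rw [Int.cast_det, fromBlocks_map, Int.cast_mul, ← h]
    congr 2 <;> ext <;> simp
  rw [hjoin]
  constructor
  · intro h
    exact ⟨Int.eq_one_of_mul_eq_one_right (nonneg hS₁) h,
      Int.eq_one_of_mul_eq_one_left (nonneg hS₂) h⟩
  · rintro ⟨h₁, h₂⟩
    rw [h₁, h₂, one_mul]
end

section
/- Let S be the skew-adjacency matrix of a tournament on 4 vertices. Then det S ∈ {1, 9}. -/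
open Matrix

/-- The determinant of a `4 × 4` skew-symmetric matrix with zero diagonal is the square of its
Pfaffian. -/
theorem det_fin_four_eq_pfaffian_sq {R : Type*} [CommRing R] {S : Matrix (Fin 4) (Fin 4) R}
    (hdiag : ∀ i, S i i = 0) (hskew : Sᵀ = -S) :
    S.det = (S 0 1 * S 2 3 - S 0 2 * S 1 3 + S 0 3 * S 1 2) ^ 2 := by
  have h (i j) : S j i = -S i j := congrFun₂ hskew i j
  simp [det_succ_row_zero, Fin.sum_univ_succ, Fin.succAbove, submatrix_apply, hdiag,
    h 0 1, h 0 2, h 0 3, h 1 2, h 1 3, h 2 3]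
  ring

theorem det_four_tournament (S : Matrix (Fin 4) (Fin 4) ℤ) (hS : IsTournament S) :
    S.det = 1 ∨ S.det = 9 := by
  obtain ⟨hdiag, hskew, hpm⟩ := hS
  rw [det_fin_four_eq_pfaffian_sq hdiag hskew]
  have mul_pm {a b : ℤ} (ha : a = 1 ∨ a = -1) (hb : b = 1 ∨ b = -1) :
      a * b = 1 ∨ a * b = -1 := by
    rcases ha with rfl | rfl <;> rcases hb with rfl | rfl <;> simp
  rcases mul_pm (hpm 0 1 (by decide)) (hpm 2 3 (by decide)) with h₁ | h₁ <;>
  rcases mul_pm (hpm 0 2 (by decide)) (hpm 1 3 (by decide)) with h₂ | h₂ <;>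
  rcases mul_pm (hpm 0 3 (by decide)) (hpm 1 2 (by decide)) with h₃ | h₃ <;>
  norm_num [h₁, h₂, h₃]
end

section
/- Let S be the skew-adjacency matrix of a unimodular tournament on n vertices (so det S = 1, and S is invertible over ℤ). Then for all i ≠ j, the entry (S⁻¹)ᵢⱼ is an odd integer. -/
open Matrix

theorem IsTournament.intCast_zmod_two {n : ℕ} {S : Matrix (Fin n) (Fin n) ℤ}
    (hS : IsTournament S) (i k : Fin n) :
    (S i k : ZMod 2) = 1 - if i = k then 1 else 0 := by
  split_ifs with h
  · simp [← h, hS.1 i]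
  · rcases hS.2.2 i k h with h | h <;> simp [h]

theorem IsTournament.sum_sub_eq_of_mul_eq_one {n : ℕ} {S T : Matrix (Fin n) (Fin n) ℤ}
    (hS : IsTournament S) (hST : S * T = 1) (i j : Fin n) :
    ∑ k, (T k j : ZMod 2) - T i j = if i = j then 1 else 0 := by
  have h := congrArg (Int.cast : ℤ → ZMod 2) (congrFun (congrFun hST i) j)
  rw [mul_apply, one_apply] at h
  push_cast at h
  simpa [hS.intCast_zmod_two, sub_mul, Finset.sum_sub_distrib] using h

theorem inverse_entries_odd {n : ℕ} (S : Matrix (Fin n) (Fin n) ℤ)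
    (hS : IsTournament S) (hdet : S.det = 1) :
    ∀ i j : Fin n, i ≠ j → Odd (S⁻¹ i j) := by
  intro i j hij
  have key := hS.sum_sub_eq_of_mul_eq_one (mul_nonsing_inv S (by simp [hdet]))
  have hsum := Finset.sum_congr rfl fun l (_ : l ∈ Finset.univ) => key l j
  have hi := key i j
  rw [if_neg hij, sub_eq_zero] at hi
  rw [← ZMod.intCast_eq_one_iff_odd, ← hi]
  simp only [Finset.sum_sub_distrib, Finset.sum_const, Finset.sum_ite_eq', Finset.mem_univ,
    if_true, nsmul_eq_mul] at hsum
  generalize ∑ k, (S⁻¹ k j : ZMod 2) = c at hsum ⊢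
  have hc : ∀ x : ZMod 2, x = 0 ∨ x = 1 := by decide
  rcases hc c with rfl | rfl
  · simp at hsum
  · rfl
end

section
/- Let S be the skew-adjacency matrix of a unimodular tournament on n vertices (det S = 1), with n ≥ 4. The following are equivalent: (i) every off-diagonal entry of S⁻¹ lies in {−1, 1} (i.e., S⁻¹ is the skew-adjacency matrix of a tournament); (ii) every principal submatrix of S of order n − 2 has determinant 1; (iii) the coefficient of x² in the characteristic polynomial det(xI − S) equals the binomial coefficient C(n,2). -/
open Matrix

/-- The principal minor of `S` on the rows and columns indexed by `I`. -/
def pminor {n : ℕ} (S : Matrix (Fin n) (Fin n) ℤ) (I : Finset (Fin n)) : ℤ :=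
  (S.submatrix (fun x : I => (x : Fin n)) (fun x : I => (x : Fin n))).det

/-- Jacobi's identity for complementary principal minors of a matrix and a right inverse. -/
theorem Matrix.det_mul_det_toSquareBlockProp_not {ι R : Type*} [Fintype ι] [DecidableEq ι]
    [CommRing R] {A B : Matrix ι ι R} (h : A * B = 1) (p : ι → Prop) [DecidablePred p] :
    A.det * (B.toSquareBlockProp fun i => ¬p i).det = (A.toSquareBlockProp p).det := by
  let e := (Equiv.sumCompl p).symm
  set A' := reindex e e A with hA'
  set B' := reindex e e B with hB'
  have hAB : A' * B' = 1 := by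
    simp [hA', hB', h]
  have hA : A'.det = A.det := det_reindex_self e A
  have hB₂₂ : B'.toBlocks₂₂ = B.toSquareBlockProp fun i => ¬p i := rfl
  have hA₁₁ : A'.toBlocks₁₁ = A.toSquareBlockProp p := rfl
  rw [← fromBlocks_toBlocks A', ← fromBlocks_toBlocks B', fromBlocks_multiply,
    ← fromBlocks_one, fromBlocks_inj] at hAB
  have hmul : A' * fromBlocks 1 B'.toBlocks₁₂ 0 B'.toBlocks₂₂ =
      fromBlocks A'.toBlocks₁₁ 0 A'.toBlocks₂₁ 1 := by
    conv_lhs => rw [← fromBlocks_toBlocks A']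
    rw [fromBlocks_multiply, hAB.2.1, hAB.2.2.2]
    simp
  simpa [hA, hB₂₂, hA₁₁] using congrArg det hmul

theorem Matrix.even_card_of_transpose_eq_neg {ι : Type*} [Fintype ι] [DecidableEq ι]
    {A : Matrix ι ι ℤ} (h : Aᵀ = -A) (hdet : A.det ≠ 0) : Even (Fintype.card ι) := by
  have hA := A.det_transpose
  rw [h, det_neg] at hA
  rcases Nat.even_or_odd (Fintype.card ι) with he | ho
  · exact he
  · rw [ho.neg_one_pow] at hA
    omega

theorem Matrix.apply_self_eq_zero_of_transpose_eq_neg {ι : Type*} {A : Matrix ι ι ℤ}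
    (h : Aᵀ = -A) (i : ι) : A i i = 0 := by
  have := congrFun₂ h i i
  simp only [transpose_apply, neg_apply] at this
  omega

theorem Matrix.transpose_inv_eq_neg {ι R : Type*} [Fintype ι] [DecidableEq ι] [CommRing R]
    {A : Matrix ι ι R} (h : Aᵀ = -A) (hA : IsUnit A.det) : A⁻¹ᵀ = -A⁻¹ := by
  rw [transpose_nonsing_inv, h]
  refine inv_eq_left_inv ?_
  rw [neg_mul_neg, nonsing_inv_mul A hA]

/-- A `2 × 2` principal minor of a skew-symmetric matrix is a square. -/
theorem Matrix.det_toSquareBlockProp_pair {ι : Type*} [DecidableEq ι] {A : Matrix ι ι ℤ}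
    (h : Aᵀ = -A) {p : ι → Prop} [Fintype {k // p k}] {i j : ι} (hij : i ≠ j)
    (hp : ∀ k, p k ↔ k = i ∨ k = j) : (A.toSquareBlockProp p).det = A i j ^ 2 := by
  let f : Fin 2 → {k // p k} := ![⟨i, (hp i).2 (.inl rfl)⟩, ⟨j, (hp j).2 (.inr rfl)⟩]
  have hf : Function.Bijective f := by
    constructor
    · intro a b hab
      fin_cases a <;> fin_cases b <;> simp_all [f, Ne.symm hij]
    · rintro ⟨k, hk⟩
      rcases (hp k).1 hk with rfl | rfl
      exacts [⟨0, rfl⟩, ⟨1, rfl⟩]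
  rw [← det_submatrix_equiv_self (Equiv.ofBijective f hf), det_fin_two]
  have hji : A j i = -A i j := congrFun₂ h i j
  simp [f, toSquareBlockProp_def, apply_self_eq_zero_of_transpose_eq_neg h, hji]
  ring

section Tournament

variable {n : ℕ} {S : Matrix (Fin n) (Fin n) ℤ}

theorem IsTournament.even (hS : IsTournament S) (hdet : S.det = 1) : Even n := by
  simpa using even_card_of_transpose_eq_neg hS.2.1 (by simp [hdet])

/-- Modulo 2, a tournament of even order is its own inverse. -/
theorem IsTournament.odd_inv_apply (hS : IsTournament S) (hdet : S.det = 1) {i j : Fin n}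
    (hij : i ≠ j) : Odd (S⁻¹ i j) := by
  let φ := Int.castRingHom (ZMod 2)
  have hn : (n : ZMod 2) = 0 := (ZMod.natCast_eq_zero_iff_even).2 (hS.even hdet)
  have hmap : φ.mapMatrix S = of (fun _ _ => 1) - 1 := by
    ext a b
    rcases eq_or_ne a b with rfl | hab
    · simp [hS.1]
    · rcases hS.2.2 a b hab with h | h <;> simp [h, hab, φ]
  have hsq : φ.mapMatrix S * φ.mapMatrix S = 1 := by
    have hJ : (of (fun _ _ => 1) : Matrix (Fin n) (Fin n) (ZMod 2)) * of (fun _ _ => 1) = 0 := by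
      ext a b
      simp [mul_apply, hn]
    rw [hmap, sub_mul, mul_sub, hJ, mul_one, one_mul]
    ext a b
    simp only [Matrix.sub_apply, of_apply, Matrix.zero_apply]
    generalize (1 : Matrix (Fin n) (Fin n) (ZMod 2)) a b = x
    revert x
    decide
  have hinv : φ.mapMatrix S * φ.mapMatrix S⁻¹ = 1 := by
    rw [← map_mul, mul_nonsing_inv S (by simp [hdet]), map_one]
  have heq : φ.mapMatrix S⁻¹ = φ.mapMatrix S := by
    calc φ.mapMatrix S⁻¹ = φ.mapMatrix S * φ.mapMatrix S * φ.mapMatrix S⁻¹ := by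
          rw [hsq, one_mul]
      _ = φ.mapMatrix S := by rw [mul_assoc, hinv, mul_one]
  have hentry := congrFun₂ (heq.trans hmap) i j
  rw [← ZMod.intCast_eq_one_iff_odd]
  simpa [hij, φ] using hentry

theorem IsTournament.pminor_eq_sq_inv (hS : IsTournament S) (hdet : S.det = 1)
    {I : Finset (Fin n)} {i j : Fin n} (hij : i ≠ j) (hI : Iᶜ = {i, j}) :
    pminor S I = S⁻¹ i j ^ 2 := by
  have hunit : IsUnit S.det := by simp [hdet]
  have hp (k : Fin n) : k ∉ I ↔ k = i ∨ k = j := by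
    rw [← Finset.mem_compl, hI, Finset.mem_insert, Finset.mem_singleton]
  have h := det_mul_det_toSquareBlockProp_not (mul_nonsing_inv S hunit) (· ∈ I)
  rw [hdet, one_mul, det_toSquareBlockProp_pair (transpose_inv_eq_neg hS.2.1 hunit) hij hp] at h
  rw [h, pminor, toSquareBlockProp, toBlock]
  congr!

theorem exists_compl_eq_pair (hn : 2 ≤ n) {I : Finset (Fin n)} (hI : I.card = n - 2) :
    ∃ i j, i ≠ j ∧ Iᶜ = {i, j} := by
  rw [← Finset.card_eq_two, Finset.card_compl, Fintype.card_fin, hI]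
  omega

theorem IsTournament.one_le_pminor (hS : IsTournament S) (hdet : S.det = 1) (hn : 2 ≤ n)
    {I : Finset (Fin n)} (hI : I.card = n - 2) : 1 ≤ pminor S I := by
  obtain ⟨i, j, hij, hc⟩ := exists_compl_eq_pair hn hI
  rw [hS.pminor_eq_sq_inv hdet hij hc]
  have hne : S⁻¹ i j ≠ 0 := fun h => by simpa [h] using hS.odd_inv_apply hdet hij
  exact (sq_pos_iff.2 hne : 0 < S⁻¹ i j ^ 2)

theorem IsTournament.charpoly_coeff_two (hS : IsTournament S) (hdet : S.det = 1) (hn : 2 ≤ n) :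
    S.charpoly.coeff 2 = ∑ I ∈ Finset.univ.powersetCard (n - 2), pminor S I := by
  have h := charpoly_coeff_eq_sum_minors S (n - 2) (by simp)
  rw [Fintype.card_fin, Nat.sub_sub_self hn,
    ((Nat.even_sub hn).2 (by simp [hS.even hdet])).neg_one_pow, one_mul] at h
  exact h

end Tournament

theorem invertible_tournament_tfae {n : ℕ} (hn : 4 ≤ n)
    (S : Matrix (Fin n) (Fin n) ℤ) (hS : IsTournament S) (hdet : S.det = 1) :
    [(∀ i j : Fin n, i ≠ j → S⁻¹ i j = 1 ∨ S⁻¹ i j = -1),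
     (∀ I : Finset (Fin n), I.card = n - 2 → pminor S I = 1),
     (S.charpoly.coeff 2 = (n.choose 2 : ℤ))].TFAE := by
  have hn₂ : 2 ≤ n := by omega
  tfae_have 1 ↔ 2 := by
    constructor
    · intro h I hI
      obtain ⟨i, j, hij, hc⟩ := exists_compl_eq_pair hn₂ hI
      rw [hS.pminor_eq_sq_inv hdet hij hc]
      exact sq_eq_one_iff.2 (h i j hij)
    · intro h i j hij
      rw [← sq_eq_one_iff, ← hS.pminor_eq_sq_inv hdet hij (compl_compl _)]
      exact h _ (by rw [Finset.card_compl, Finset.card_pair hij, Fintype.card_fin])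
  tfae_have 2 ↔ 3 := by
    have hle : ∀ I ∈ Finset.univ.powersetCard (n - 2), 1 ≤ pminor S I := fun I hI =>
      hS.one_le_pminor hdet hn₂ (Finset.mem_powersetCard_univ.1 hI)
    have hsum := Finset.sum_eq_sum_iff_of_le hle
    rw [← hS.charpoly_coeff_two hdet hn₂, Finset.sum_const, Finset.card_powersetCard,
      Finset.card_univ, Fintype.card_fin, Nat.choose_symm hn₂, nsmul_one] at hsum
    rw [eq_comm (a := S.charpoly.coeff 2), hsum]
    simp only [Finset.mem_powersetCard_univ, eq_comm]
  tfae_finish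
end

section
/- Let S be the skew-adjacency matrix of a tournament on n vertices and let Ŝ be the 2n×2n block matrix [[S, S + Iₙ], [S − Iₙ, S]]. Then Ŝ · [[S, −(S + Iₙ)], [−(S − Iₙ), S]] = I₂ₙ; in particular Ŝ is invertible with integer inverse [[S, −(S + Iₙ)], [−(S − Iₙ), S]], and det Ŝ = 1. -/
open Matrix

namespace Matrix

variable {m R : Type*} [Fintype m] [DecidableEq m] [CommRing R]

theorem fromBlocks_add_one_sub_one_mul (A : Matrix m m R) :
    fromBlocks A (A + 1) (A - 1) A * fromBlocks A (-(A + 1)) (-(A - 1)) A = 1 := by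
  rw [fromBlocks_multiply, ← fromBlocks_one]
  congr 1 <;> noncomm_ring

theorem det_fromBlocks_add_one_sub_one (A : Matrix m m R) :
    (fromBlocks A (A + 1) (A - 1) A).det = 1 := by
  have h : fromBlocks A (A + 1) (A - 1) A =
      fromBlocks 1 1 0 1 * fromBlocks 1 1 (A - 1) A := by
    rw [fromBlocks_multiply]
    congr 1 <;> noncomm_ring
  rw [h, det_mul, det_fromBlocks_zero₂₁, det_fromBlocks_one₁₁]
  simp

end Matrix

theorem hat_matrix_unimodular {n : ℕ} (S : Matrix (Fin n) (Fin n) ℤ)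
    (hS : IsTournament S) :
    Matrix.fromBlocks S (S + 1) (S - 1) S *
        Matrix.fromBlocks S (-(S + 1)) (-(S - 1)) S = 1 ∧
      (Matrix.fromBlocks S (S + 1) (S - 1) S)⁻¹ =
        Matrix.fromBlocks S (-(S + 1)) (-(S - 1)) S ∧
      (Matrix.fromBlocks S (S + 1) (S - 1) S).det = 1 :=
  have h := fromBlocks_add_one_sub_one_mul S
  ⟨h, inv_eq_right_inv h, det_fromBlocks_add_one_sub_one S⟩
end

section
/- Let S be the skew-adjacency matrix of a tournament on n vertices, let Ŝ = [[S, S + Iₙ], [S − Iₙ, S]], and let D = [[Iₙ, 0], [0, −Iₙ]]. Then Ŝ⁻¹ = D Ŝ D. Consequently the characteristic polynomial φ(x) = det(xI₂ₙ − Ŝ) is palindromic: for every k with 0 ≤ k ≤ 2n, the coefficient of x^k in φ equals the coefficient of x^{2n−k}. -/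
open Matrix

namespace Matrix

variable {m R : Type*} [Fintype m] [DecidableEq m] [CommRing R]

theorem det_fromBlocks_self_add_one_sub_one (S : Matrix m m R) :
    (fromBlocks S (S + 1) (S - 1) S).det = 1 := by
  have h : fromBlocks S (S + 1) (S - 1) S =
      fromBlocks 1 1 0 1 * fromBlocks 1 1 (S - 1) S := by
    simp [fromBlocks_multiply, add_comm]
  rw [h, det_mul, det_fromBlocks_zero₂₁, det_fromBlocks_one₁₁]
  simp

theorem inv_fromBlocks_self_add_one_sub_one (S : Matrix m m R) :
    (fromBlocks S (S + 1) (S - 1) S)⁻¹ =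
      fromBlocks (1 : Matrix m m R) 0 0 (-1) * fromBlocks S (S + 1) (S - 1) S *
        fromBlocks (1 : Matrix m m R) 0 0 (-1) := by
  apply inv_eq_right_inv
  simp only [fromBlocks_multiply, ← fromBlocks_one]
  congr 1 <;> noncomm_ring

theorem charpoly_mul_mul_of_mul_eq_one {A D : Matrix m m R} (h : D * D = 1) :
    (D * A * D).charpoly = A.charpoly := by
  rw [charpoly_mul_comm, ← Matrix.mul_assoc, h, Matrix.one_mul]

theorem charpoly_reverse_of_charpoly_inv_eq {A : Matrix m m R} (hdet : A.det = 1)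
    (hcard : Even (Fintype.card m)) (h : A⁻¹.charpoly = A.charpoly) :
    A.charpoly.reverse = A.charpoly := by
  have hA : IsUnit A := by simp [isUnit_iff_isUnit_det, hdet]
  have := charpoly_inv A hA
  rw [h, hdet, hcard.neg_one_pow] at this
  simpa [reverse_charpoly] using this.symm

end Matrix

theorem hat_matrix_palindromic {n : ℕ} (S : Matrix (Fin n) (Fin n) ℤ)
    (hS : IsTournament S) :
    (Matrix.fromBlocks S (S + 1) (S - 1) S)⁻¹ =
        Matrix.fromBlocks (1 : Matrix (Fin n) (Fin n) ℤ) 0 0 (-1) *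
          Matrix.fromBlocks S (S + 1) (S - 1) S *
          Matrix.fromBlocks (1 : Matrix (Fin n) (Fin n) ℤ) 0 0 (-1) ∧
      ∀ k : ℕ, k ≤ 2 * n →
        (Matrix.fromBlocks S (S + 1) (S - 1) S).charpoly.coeff k =
          (Matrix.fromBlocks S (S + 1) (S - 1) S).charpoly.coeff (2 * n - k) := by
  refine ⟨inv_fromBlocks_self_add_one_sub_one S, fun k hk => ?_⟩
  have hrev : (fromBlocks S (S + 1) (S - 1) S).charpoly.reverse =
      (fromBlocks S (S + 1) (S - 1) S).charpoly := by
    apply charpoly_reverse_of_charpoly_inv_eq (det_fromBlocks_self_add_one_sub_one S) (by simp)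
    rw [inv_fromBlocks_self_add_one_sub_one, charpoly_mul_mul_of_mul_eq_one]
    simp [fromBlocks_multiply]
  have hdeg : (fromBlocks S (S + 1) (S - 1) S).charpoly.natDegree = 2 * n := by
    simp [charpoly_natDegree_eq_dim, two_mul]
  conv_lhs => rw [← hrev, Polynomial.coeff_reverse, hdeg, Polynomial.revAt_le hk]
end

section
/- Let S be the skew-adjacency matrix of a tournament T on n vertices, and suppose there is a subset W of {1,…,n} with |W| = n − k such that det S[W] = 1 (T has a unimodular induced subtournament on n − k vertices). Then there exists a skew-adjacency matrix S' of a tournament on n + k vertices such that det S' = 1 and S is a principal submatrix of S' (T embeds as an induced subtournament of a unimodular tournament obtained by adding k vertices). -/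
open Matrix

/-- The 0-1 matrix of the inclusion of the subtype of `p`. -/
def inclusionMatrix {m : Type*} [DecidableEq m] (p : m → Prop) : Matrix m {x // p x} ℤ :=
  Matrix.of fun i j => if i = j then 1 else 0

/-- The matrix obtained from `S` by adding, for every index satisfying `p`, a twin of that index
which the index dominates. -/
def twinExtension {m : Type*} [DecidableEq m] (S : Matrix m m ℤ) (p : m → Prop) :
    Matrix (m ⊕ {x // p x}) (m ⊕ {x // p x}) ℤ :=
  fromBlocks S (S.submatrix id Subtype.val + inclusionMatrix p)
    (S.submatrix Subtype.val id - (inclusionMatrix p)ᵀ) (S.submatrix Subtype.val Subtype.val)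

section

variable {m : Type*} [Fintype m] [DecidableEq m]

theorem mul_inclusionMatrix {l : Type*} (M : Matrix l m ℤ) (p : m → Prop) :
    M * inclusionMatrix p = M.submatrix id Subtype.val := by
  ext i j
  simp [inclusionMatrix, Matrix.mul_apply]

theorem inclusionMatrix_transpose_mul_self (p : m → Prop) :
    (inclusionMatrix p)ᵀ * inclusionMatrix p = 1 := by
  rw [mul_inclusionMatrix]
  ext i j
  simp [inclusionMatrix, Matrix.one_apply, Subtype.ext_iff, eq_comm (a := j.1)]

theorem inclusionMatrix_mul_apply {l : Type*} (p : m → Prop) [DecidablePred p]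
    (M : Matrix m l ℤ) (i : m) (j : l) :
    (inclusionMatrix p * (M.submatrix Subtype.val id : Matrix {x // p x} l ℤ)) i j =
      if p i then M i j else 0 := by
  simp only [Matrix.mul_apply, inclusionMatrix, Matrix.submatrix_apply, id, Matrix.of_apply]
  split_ifs with h
  · rw [Finset.sum_eq_single ⟨i, h⟩]
    · simp
    · rintro ⟨b, hb⟩ - hne
      have : i ≠ b := fun e => hne (by simp [e])
      simp [this]
    · simp
  · refine Finset.sum_eq_zero fun b _ => ?_
    have : i ≠ b := fun e => h (e ▸ b.2)
    simp [this]

theorem det_twinExtension (S : Matrix m m ℤ) (p : m → Prop) [DecidablePred p] :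
    (twinExtension S p).det = (S.toSquareBlockProp fun x => ¬ p x).det := by
  let R : Matrix {x // p x} m ℤ := (S - 1).submatrix Subtype.val id
  have hop : twinExtension S p * fromBlocks 1 (-inclusionMatrix p) 0 1 =
      fromBlocks S (inclusionMatrix p) R 1 := by
    simp only [twinExtension, fromBlocks_multiply, Matrix.mul_one, Matrix.mul_zero, add_zero,
      Matrix.mul_neg, Matrix.sub_mul, inclusionMatrix_transpose_mul_self]
    simp only [mul_inclusionMatrix]
    congr 1
    · abel
    · ext i j
      simp [R, inclusionMatrix, Matrix.one_apply, eq_comm]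
    · simp
  have hR (i j : m) : (S - inclusionMatrix p * R) i j =
      if p i then (1 : Matrix m m ℤ) i j else S i j := by
    rw [Matrix.sub_apply, inclusionMatrix_mul_apply]
    split_ifs <;> simp
  have hdet := congrArg Matrix.det hop
  rw [det_mul, det_fromBlocks_zero₂₁, det_one, det_one, mul_one, mul_one,
    det_fromBlocks_one₂₂] at hdet
  rw [hdet, Matrix.twoBlockTriangular_det' _ p]
  · have hp : toSquareBlockProp (S - inclusionMatrix p * R) p = 1 := by
      ext i j
      simp [toSquareBlockProp_def, hR, i.2, Matrix.one_apply, Subtype.ext_iff]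
    have hnp : toSquareBlockProp (S - inclusionMatrix p * R) (fun x => ¬ p x) =
        S.toSquareBlockProp fun x => ¬ p x := by
      ext i j
      simp [toSquareBlockProp_def, hR, i.2]
    rw [hp, hnp, det_one, one_mul]
  · intro i hi j hj
    have hij : i ≠ j := fun h => hj (h ▸ hi)
    simp [hR, hi, hij]

end

theorem isTournament_reindex_twinExtension {n N : ℕ} {S : Matrix (Fin n) (Fin n) ℤ}
    (hS : IsTournament S) (p : Fin n → Prop) (e : Fin n ⊕ {x // p x} ≃ Fin N) :
    IsTournament (reindex e e (twinExtension S p)) := by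
  obtain ⟨h0, hT, h1⟩ := hS
  have hskew : ∀ i j, S j i = -S i j := fun i j => congrFun (congrFun hT i) j
  refine ⟨fun i => ?_, ?_, fun i j hij => ?_⟩
  · obtain ⟨x, rfl⟩ := e.surjective i
    rcases x with x | x <;> simp [twinExtension, h0]
  · ext i j
    obtain ⟨x, rfl⟩ := e.surjective i
    obtain ⟨y, rfl⟩ := e.surjective j
    rcases x with x | x <;> rcases y with y | y <;>
      simp [twinExtension, inclusionMatrix, hskew y x, add_comm, sub_eq_add_neg]
  · obtain ⟨x, rfl⟩ := e.surjective i
    obtain ⟨y, rfl⟩ := e.surjective j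
    rcases x with x | x <;> rcases y with y | y
    · simpa [twinExtension] using h1 x y fun h => hij (by rw [h])
    · by_cases h : x = y
      · simp [twinExtension, inclusionMatrix, h, h0]
      · simpa [twinExtension, inclusionMatrix, h] using h1 x y h
    · by_cases h : y = x
      · simp [twinExtension, inclusionMatrix, h, h0]
      · simpa [twinExtension, inclusionMatrix, h] using h1 x y (Ne.symm h)
    · simpa [twinExtension] using h1 x y fun h => hij (by rw [Subtype.ext h])

theorem embed_in_unimodular_of_unimodular_sub {n k : ℕ} (hk : k ≤ n)
    (S : Matrix (Fin n) (Fin n) ℤ) (hS : IsTournament S)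
    (W : Finset (Fin n)) (hW : W.card = n - k) (hWdet : pminor S W = 1) :
    ∃ S' : Matrix (Fin (n + k)) (Fin (n + k)) ℤ,
      IsTournament S' ∧ S'.det = 1 ∧
        ∃ f : Fin n ↪ Fin (n + k), ∀ i j, S' (f i) (f j) = S i j := by
  have hcard : Fintype.card (Fin n ⊕ {x // x ∉ W}) = Fintype.card (Fin (n + k)) := by
    simp only [Fintype.card_sum, Fintype.card_fin, Fintype.card_subtype_compl,
      Fintype.card_coe, hW]
    omega
  let e := Fintype.equivOfCardEq hcard
  refine ⟨reindex e e (twinExtension S (· ∉ W)), isTournament_reindex_twinExtension hS _ e, ?_,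
    Function.Embedding.inl.trans e.toEmbedding, fun i j => by simp [twinExtension]⟩
  rw [det_reindex_self, det_twinExtension, ← hWdet, pminor]
  exact (det_submatrix_equiv_self (Equiv.subtypeEquivRight fun x => (not_not (a := x ∈ W)).symm)
    (S.toSquareBlockProp fun x => ¬ x ∉ W)).symm
end

section
/- Let S be the skew-adjacency matrix of a tournament on n ≥ 2 vertices. Then there exists a skew-adjacency matrix S' of a tournament on m vertices with m ≤ 2n − ⌊log₂ n⌋ such that det S' = 1 and S is a principal submatrix of S'. That is, every n-tournament can be embedded in a unimodular tournament by adding at most n − ⌊log₂ n⌋ vertices. -/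
open Matrix

/-- The block matrix obtained from a skew matrix by adding a dominated twin of every vertex has
determinant one. -/
theorem det_twin_block {κ : Type*} [Fintype κ] [DecidableEq κ] (D : Matrix κ κ ℤ) :
    (fromBlocks D (D + 1) (D - 1) D).det = 1 := by
  have h : fromBlocks D (D + 1) (D - 1) D =
      fromBlocks 1 0 1 1 * fromBlocks 1 (-D) 0 1 * fromBlocks 1 1 0 1 * fromBlocks 1 0 (-1) 1 *
        fromBlocks 1 1 0 1 * fromBlocks 1 1 0 1 := by
    simp only [fromBlocks_multiply]
    congr 1 <;> simp <;> abel
  rw [h]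
  simp

/-- Adding twins of the vertices in `κ` leaves the determinant of the remaining part. -/
theorem det_add_twins {ι κ : Type*} [Fintype ι] [DecidableEq ι] [Fintype κ] [DecidableEq κ]
    (P : Matrix ι ι ℤ) (Q : Matrix ι κ ℤ) (R : Matrix κ ι ℤ) (D : Matrix κ κ ℤ) :
    (fromBlocks P (fromCols Q Q) (fromRows R R) (fromBlocks D (D + 1) (D - 1) D)).det = P.det := by
  have hinv : fromBlocks D (D + 1) (D - 1) D * fromBlocks D (-1 - D) (1 - D) D = 1 := by
    rw [fromBlocks_multiply, ← fromBlocks_one]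
    congr 1 <;> noncomm_ring
  let _ := invertibleOfRightInverse _ _ hinv
  rw [det_fromBlocks₂₂, det_twin_block, invOf_eq_right_inv hinv, one_mul,
    fromCols_mul_fromBlocks, fromCols_mul_fromRows, ← Matrix.add_mul, ← Matrix.mul_add,
    ← Matrix.mul_add, ← Matrix.mul_add]
  simp

/-- Adding an arc whose two ends do not distinguish the other vertices preserves the determinant. -/
theorem det_add_arc {ι : Type*} [Fintype ι] [DecidableEq ι] (D : Matrix ι ι ℤ) {a : ℤ}
    (ha : a * a = 1) (b : Fin 2 → ℤ) :
    (fromBlocks !![0, a; -a, 0] (of fun i _ => b i) (of fun _ i => -b i) D).det = D.det := by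
  have hinv : !![0, a; -a, 0] * !![0, -a; a, 0] = 1 := by
    ext i j
    fin_cases i <;> fin_cases j <;> simp [ha]
  let _ := invertibleOfRightInverse _ _ hinv
  rw [det_fromBlocks₁₁, invOf_eq_right_inv hinv]
  have h : (of fun (_ : ι) i => -b i) * !![0, -a; a, 0] * (of fun i (_ : ι) => b i) = 0 := by
    ext i j
    simp [Matrix.mul_apply, Fin.sum_univ_two]
    ring
  rw [h]
  simp [det_fin_two, ha]

theorem IsTournament.apply_swap {n : ℕ} {S : Matrix (Fin n) (Fin n) ℤ} (hS : IsTournament S)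
    (i j : Fin n) : S j i = -S i j :=
  congrFun (congrFun hS.2.1 i) j

/-- A large vertex set contains many vertices that two given vertices do not distinguish. -/
theorem exists_undistinguished_subset {n : ℕ} {S : Matrix (Fin n) (Fin n) ℤ} (hS : IsTournament S)
    (U : Finset (Fin n)) (v w : Fin n) {k : ℕ} (hU : 4 * k ≤ U.card) (hv : v ∈ U) (hw : w ∈ U)
    (hvw : v ≠ w) :
    ∃ b : Fin 2 → ℤ, ∃ T ⊆ (U.erase v).erase w, k ≤ T.card ∧
      ∀ x ∈ T, S v x = b 0 ∧ S w x = b 1 := by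
  have hcard : ((U.erase v).erase w).card + 2 = U.card := by
    have h1 := Finset.card_erase_add_one hv
    have h2 := Finset.card_erase_add_one (Finset.mem_erase.2 ⟨hvw.symm, hw⟩)
    omega
  rcases Nat.eq_zero_or_pos k with rfl | hk
  · exact ⟨0, ∅, by simp, by simp, by simp⟩
  let E : Finset ℤ := {1, -1}
  have hmaps : ∀ x ∈ (U.erase v).erase w, (S v x, S w x) ∈ E ×ˢ E := by
    intro x hx
    simp only [Finset.mem_erase] at hx
    simp only [E, Finset.mem_product, Finset.mem_insert, Finset.mem_singleton]
    exact ⟨hS.2.2 _ _ (Ne.symm hx.2.1), hS.2.2 _ _ (Ne.symm hx.1)⟩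
  have hE : (E ×ˢ E).card = 4 := by decide
  have hlt : (E ×ˢ E).card * (k - 1) < ((U.erase v).erase w).card := by
    rw [hE]
    omega
  obtain ⟨y, -, hy⟩ := Finset.exists_lt_card_fiber_of_mul_lt_card_of_maps_to hmaps hlt
  refine ⟨![y.1, y.2], _, Finset.filter_subset (fun x => (S v x, S w x) = y) _, by omega,
    fun x hx => ?_⟩
  have h := (Finset.mem_filter.1 hx).2
  simp [← h]

/-- A vertex set of size at least `2 ^ j` contains a unimodular subtournament on at least `j`
vertices. -/
theorem exists_unimodular_subtournament {n : ℕ} {S : Matrix (Fin n) (Fin n) ℤ}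
    (hS : IsTournament S) (j : ℕ) (U : Finset (Fin n)) (hU : 2 ^ j ≤ U.card) :
    ∃ k ≥ j, ∃ f : Fin k → Fin n, f.Injective ∧ (∀ i, f i ∈ U) ∧ (S.submatrix f f).det = 1 := by
  induction j using Nat.strong_induction_on generalizing U with
  | _ j ih =>
    rcases Nat.eq_zero_or_pos j with rfl | hj
    · exact ⟨0, le_rfl, Fin.elim0, fun i => i.elim0, fun i => i.elim0, by simp⟩
    have hone : 1 < U.card := lt_of_lt_of_le (Nat.one_lt_two_pow hj.ne') hU
    obtain ⟨v, hv, w, hw, hvw⟩ := Finset.one_lt_card.1 hone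
    obtain ⟨k, hk, f, hf, hfU, hdet, b, hb⟩ : ∃ k ≥ j - 2, ∃ f : Fin k → Fin n, f.Injective ∧
        (∀ i, f i ∈ (U.erase v).erase w) ∧ (S.submatrix f f).det = 1 ∧
        ∃ b : Fin 2 → ℤ, ∀ i, S v (f i) = b 0 ∧ S w (f i) = b 1 := by
      obtain rfl | hj2 : j = 1 ∨ 2 ≤ j := by omega
      · exact ⟨0, by simp, Fin.elim0, fun i => i.elim0, fun i => i.elim0, by simp,
          0, fun i => i.elim0⟩
      have hpow : 4 * 2 ^ (j - 2) ≤ U.card := by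
        obtain ⟨i, rfl⟩ := Nat.exists_eq_add_of_le' hj2
        simp only [Nat.add_sub_cancel, pow_add] at hU ⊢
        omega
      obtain ⟨b, T, hTU, hT, hb⟩ := exists_undistinguished_subset hS U v w hpow hv hw hvw
      obtain ⟨k, hk, f, hf, hfT, hdet⟩ := ih (j - 2) (by omega) T hT
      exact ⟨k, hk, f, hf, fun i => hTU (hfT i), hdet, b, fun i => hb _ (hfT i)⟩
    simp only [Finset.mem_erase] at hfU
    let g : Fin 2 ⊕ Fin k → Fin n := Sum.elim ![v, w] f
    have hg : g.Injective := by
      refine Function.Injective.sumElim ?_ hf ?_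
      · intro a c
        fin_cases a <;> fin_cases c <;> simp [hvw, hvw.symm]
      · intro a c
        fin_cases a
        · exact (hfU c).2.1.symm
        · exact (hfU c).1.symm
    refine ⟨2 + k, by omega, g ∘ finSumFinEquiv.symm, hg.comp finSumFinEquiv.symm.injective,
      fun i => ?_, ?_⟩
    · rw [Function.comp_apply]
      rcases finSumFinEquiv.symm i with a | c
      · fin_cases a
        · exact hv
        · exact hw
      · exact (hfU c).2.2
    · have ha : S v w * S v w = 1 := by rcases hS.2.2 v w hvw with h | h <;> simp [h]
      rw [← submatrix_submatrix, det_submatrix_equiv_self, ← hdet,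
        ← det_add_arc (S.submatrix f f) ha b]
      congr 1
      ext (x | x) (y | y)
      · fin_cases x <;> fin_cases y <;> simp [g, hS.1, hS.apply_swap v w]
      · fin_cases x <;> simp [g, hb]
      · fin_cases y <;> simp [g, hS.apply_swap _ (f x), hb]
      · rfl

theorem embed_in_unimodular {n : ℕ} (hn : 2 ≤ n)
    (S : Matrix (Fin n) (Fin n) ℤ) (hS : IsTournament S) :
    ∃ m : ℕ, m ≤ 2 * n - Nat.log 2 n ∧
      ∃ S' : Matrix (Fin m) (Fin m) ℤ,
        IsTournament S' ∧ S'.det = 1 ∧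
          ∃ f : Fin n ↪ Fin m, ∀ i j, S' (f i) (f j) = S i j := by
  classical
  obtain ⟨k, hk, f, hf, -, hdet⟩ := exists_unimodular_subtournament hS (Nat.log 2 n) Finset.univ
    (by simpa using Nat.pow_log_le_self 2 (by omega))
  let κ := ((Set.range f)ᶜ : Set (Fin n))
  let e : Fin k ⊕ κ ≃ Fin n :=
    ((Equiv.ofInjective f hf).sumCongr (Equiv.refl _)).trans (Equiv.Set.sumCompl _)
  have he (i : Fin k) : e (Sum.inl i) = f i := rfl
  have hc (i : κ) : e (Sum.inr i) = i := rfl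
  have hne (i : Fin k) (c : κ) : f i ≠ c := fun h => c.2 ⟨i, h⟩
  have hcard : k + Fintype.card κ = n := by simpa using Fintype.card_congr e
  let c : κ → Fin n := Subtype.val
  let D := S.submatrix c c
  let N : Matrix (Fin k ⊕ (κ ⊕ κ)) (Fin k ⊕ (κ ⊕ κ)) ℤ :=
    fromBlocks (S.submatrix f f) (fromCols (S.submatrix f c) (S.submatrix f c))
      (fromRows (S.submatrix c f) (S.submatrix c f)) (fromBlocks D (D + 1) (D - 1) D)
  have hdiag (x) : N x x = 0 := by
    rcases x with x | x | x <;> simp [N, D, hS.1]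
  have hskew (x y) : N y x = -N x y := by
    have hff (x y : Fin k) := hS.apply_swap (f x) (f y)
    have hfc (x : Fin k) (y : κ) := hS.apply_swap (f x) (c y)
    have hcf (x : κ) (y : Fin k) := hS.apply_swap (c x) (f y)
    have hcc (x y : κ) := hS.apply_swap (c x) (c y)
    rcases x with x | x | x <;> rcases y with y | y | y <;>
      simp only [N, D, fromBlocks_apply₁₁, fromBlocks_apply₁₂, fromBlocks_apply₂₁,
        fromBlocks_apply₂₂, fromCols_apply_inl, fromCols_apply_inr, fromRows_apply_inl,
        fromRows_apply_inr, submatrix_apply, Matrix.add_apply, Matrix.sub_apply, one_apply] <;>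
      grind
  have hentry (x y) (hxy : x ≠ y) : N x y = 1 ∨ N x y = -1 := by
    have hcc (x y : κ) (h : x ≠ y) : S x y = 1 ∨ S x y = -1 :=
      hS.2.2 _ _ (Subtype.coe_injective.ne h)
    have hff (x y : Fin k) (h : x ≠ y) := hS.2.2 _ _ (hf.ne h)
    have hfc (x : Fin k) (y : κ) := hS.2.2 _ _ (hne x y)
    have hcf (x : Fin k) (y : κ) := hS.2.2 _ _ (hne x y).symm
    rcases x with x | x | x <;> rcases y with y | y | y <;> simp at hxy <;>
      simp only [N, D, c, fromBlocks_apply₁₁, fromBlocks_apply₁₂, fromBlocks_apply₂₁,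
        fromBlocks_apply₂₂, fromCols_apply_inl, fromCols_apply_inr, fromRows_apply_inl,
        fromRows_apply_inr, submatrix_apply, Matrix.add_apply,
        Matrix.sub_apply] <;>
      first
      | exact hff _ _ hxy
      | exact hfc _ _
      | exact hcf _ _
      | exact hcc _ _ hxy
      | (by_cases h : x = y
         · subst h; simp [hS.1]
         · simpa [h] using hcc _ _ h)
  let E : Fin (k + (Fintype.card κ + Fintype.card κ)) ≃ Fin k ⊕ (κ ⊕ κ) :=
    (Fintype.equivFinOfCardEq (by simp)).symm
  let g : Fin n → Fin k ⊕ (κ ⊕ κ) := Sum.map id Sum.inl ∘ e.symm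
  have hg : g.Injective :=
    (Function.Injective.sumMap Function.injective_id Sum.inl_injective).comp e.symm.injective
  refine ⟨_, by omega, N.submatrix E E, ⟨fun i => hdiag _, ?_, fun i j h => ?_⟩, ?_,
    ⟨E.symm ∘ g, E.symm.injective.comp hg⟩, fun i j => ?_⟩
  · ext i j
    exact hskew _ _
  · exact hentry _ _ (E.injective.ne h)
  · rw [det_submatrix_equiv_self, det_add_twins, hdet]
  · obtain ⟨x, rfl⟩ := e.surjective i
    obtain ⟨y, rfl⟩ := e.surjective j
    have hge (x) : g (e x) = Sum.map id Sum.inl x := by simp [g]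
    simp only [submatrix_apply, Function.Embedding.coeFn_mk, Function.comp_apply,
      Equiv.apply_symm_apply, hge]
    rcases x with x | x <;> rcases y with y | y <;> simp [N, D, c, he, hc]
end

section
/- Let A be an m×m complex Hermitian matrix and let B be a principal submatrix of A of order n (obtained by restricting A to a subset of n indices). If λ is an eigenvalue of B with multiplicity r (as a root of the characteristic polynomial of B) and m − n < r, then λ is an eigenvalue of A. -/
open Matrix Polynomial

/-- The geometric and algebraic multiplicities of a value coincide for a Hermitian matrix. -/
theorem Matrix.IsHermitian.finrank_eigenspace_toEuclideanLin {𝕜 ι : Type*} [RCLike 𝕜]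
    [Fintype ι] [DecidableEq ι] {B : Matrix ι ι 𝕜} (hB : B.IsHermitian) (μ : 𝕜) :
    Module.finrank 𝕜 (Module.End.eigenspace (toEuclideanLin B) μ) =
      B.charpoly.rootMultiplicity μ := by
  have hsymm : (toEuclideanLin B).IsSymmetric := isSymmetric_toEuclideanLin_iff.mpr hB
  rw [← hsymm.isFinitelySemisimple.maxGenEigenspace_eq_eigenspace,
    LinearMap.finrank_maxGenEigenspace_eq, toEuclideanLin_eq_toLin_orthonormal,
    Matrix.charpoly_toLin]

theorem Matrix.mulVec_extend_zero_apply {R ι κ : Type*} [NonUnitalNonAssocSemiring R]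
    [Fintype ι] [Fintype κ] (A : Matrix ι ι R) (f : κ ↪ ι) (v : κ → R) (i : κ) :
    (A *ᵥ Function.extend f v 0) (f i) = (A.submatrix f f *ᵥ v) i := by
  refine (Fintype.sum_of_injective f f.injective _ _ (fun j hj => ?_) fun j => ?_).symm
  · rw [Function.extend_apply' _ _ _ (by simpa using hj), Pi.zero_apply, mul_zero]
  · rw [f.injective.extend_apply]
    rfl

theorem eigenvalue_of_principal_submatrix {m n : ℕ}
    (A : Matrix (Fin m) (Fin m) ℂ) (hA : A.IsHermitian)
    (f : Fin n ↪ Fin m) (lam : ℂ) (r : ℕ)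
    (hr : (A.submatrix f f).charpoly.rootMultiplicity lam = r)
    (hroot : (A.submatrix f f).charpoly.IsRoot lam)
    (hmn : m - n < r) :
    A.charpoly.IsRoot lam := by
  classical
  set V := Module.End.eigenspace (toEuclideanLin (A.submatrix f f)) lam
  have hV : Module.finrank ℂ V = r :=
    ((hA.submatrix f).finrank_eigenspace_toEuclideanLin lam).trans hr
  let E : V →ₗ[ℂ] (Fin m → ℂ) :=
    Function.ExtendByZero.linearMap ℂ f ∘ₗ (WithLp.linearEquiv 2 ℂ (Fin n → ℂ)).toLinearMap ∘ₗ
      V.subtype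
  let T : V →ₗ[ℂ] ({j // j ∉ Set.range f} → ℂ) :=
    LinearMap.funLeft ℂ ℂ Subtype.val ∘ₗ (scalar (Fin m) lam - A).mulVecLin ∘ₗ E
  have hT : LinearMap.ker T ≠ ⊥ := by
    apply LinearMap.ker_ne_bot_of_finrank_lt
    rw [hV, Module.finrank_fintype_fun_eq_card, Fintype.card_subtype_compl]
    rwa [Fintype.card_fin, ← Fintype.card_congr (Equiv.ofInjective f f.injective), Fintype.card_fin]
  obtain ⟨v, hv, hv0⟩ := Submodule.exists_mem_ne_zero_of_ne_bot hT
  have hE (i : Fin n) : E v (f i) = (v : EuclideanSpace ℂ (Fin n)) i :=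
    f.injective.extend_apply _ _ _
  rw [IsRoot, eval_charpoly, ← exists_mulVec_eq_zero_iff]
  refine ⟨E v, fun h => hv0 ?_, funext fun j => ?_⟩
  · ext i
    simpa [← hE] using congrFun h (f i)
  · by_cases hj : j ∈ Set.range f
    · obtain ⟨i, rfl⟩ := hj
      have heig := congrArg (fun w : EuclideanSpace ℂ (Fin n) => w i)
        (Module.End.mem_eigenspace_iff.mp v.2)
      have hAE : (A *ᵥ E v) (f i) = (A.submatrix f f *ᵥ (v : EuclideanSpace ℂ (Fin n)).ofLp) i :=
        mulVec_extend_zero_apply A f _ i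
      simp only [toLpLin_apply, PiLp.smul_apply, smul_eq_mul] at heig
      simp [sub_mulVec, hAE, heig, hE, ← smul_one_eq_diagonal, smul_mulVec]
    · exact congrFun (LinearMap.mem_ker.mp hv) ⟨j, hj⟩
end

section
/- Let S be the skew-adjacency matrix of a tournament T on n vertices, and suppose iλ is an eigenvalue of S (over ℂ) with multiplicity r as a root of the characteristic polynomial of S, where iλ is not an algebraic unit. Then every tournament T' on m vertices that contains T as an induced subtournament and is unimodular satisfies m ≥ n + r. (Thus the maximum multiplicity ν(T) among non-unit eigenvalues of S is a lower bound on the number u⁺(T) of vertices that must be added to T to obtain a unimodular tournament.) -/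
open Matrix Polynomial

/-- An eigenvalue of an integer matrix is an algebraic integer. -/
lemma isIntegral_of_int_mulVec_eq_smul {ι : Type*} [Fintype ι] [DecidableEq ι]
    (A : Matrix ι ι ℤ) {μ : ℂ} {w : ι → ℂ} (hw : w ≠ 0)
    (h : A.map (Int.cast : ℤ → ℂ) *ᵥ w = μ • w) : IsIntegral ℤ μ := by
  refine ⟨A.charpoly, A.charpoly_monic, ?_⟩
  have hdet : (Matrix.scalar ι μ - A.map (Int.cast : ℤ → ℂ)).det = 0 := by
    rw [← Matrix.exists_mulVec_eq_zero_iff]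
    refine ⟨w, hw, ?_⟩
    rw [Matrix.sub_mulVec, h, Matrix.scalar_apply, ← Matrix.smul_one_eq_diagonal,
      Matrix.smul_mulVec, Matrix.one_mulVec, sub_self]
  rw [← Matrix.eval_charpoly] at hdet
  rw [← Polynomial.eval_map, ← Matrix.charpoly_map]
  exact hdet

/-- An eigenvalue of an integer matrix of determinant one is an algebraic unit. -/
lemma isUnit_eigenvalue_of_int_det_eq_one {ι : Type*} [Fintype ι] [DecidableEq ι]
    (A : Matrix ι ι ℤ) (hA : A.det = 1) {μ : ℂ} {w : ι → ℂ} (hw : w ≠ 0)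
    (h : A.map (Int.cast : ℤ → ℂ) *ᵥ w = μ • w) :
    IsIntegral ℤ μ ∧ μ ≠ 0 ∧ IsIntegral ℤ μ⁻¹ := by
  have hinv : A.adjugate.map (Int.cast : ℤ → ℂ) * A.map (Int.cast : ℤ → ℂ) = 1 := by
    have := congrArg (Int.castRingHom ℂ).mapMatrix A.adjugate_mul
    rw [hA, one_smul, map_mul, map_one] at this
    exact this
  have hw_smul : w = μ • (A.adjugate.map (Int.cast : ℤ → ℂ) *ᵥ w) := by
    rw [← Matrix.mulVec_smul, ← h, Matrix.mulVec_mulVec, hinv, Matrix.one_mulVec]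
  have hμ : μ ≠ 0 := by
    rintro rfl
    exact hw (by simpa using hw_smul)
  refine ⟨isIntegral_of_int_mulVec_eq_smul A hw h, hμ,
    isIntegral_of_int_mulVec_eq_smul A.adjugate hw ?_⟩
  rw [eq_inv_smul_iff₀ hμ]
  exact hw_smul.symm

/-- The eigenvalues of a skew-Hermitian matrix are semisimple. -/
lemma finrank_eigenspace_toEuclideanLin_of_conjTranspose_eq_neg {ι : Type*} [Fintype ι]
    [DecidableEq ι] (A : Matrix ι ι ℂ) (hA : Aᴴ = -A) (μ : ℂ) :
    Module.finrank ℂ (Module.End.eigenspace (Matrix.toEuclideanLin A) μ) =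
      A.charpoly.rootMultiplicity μ := by
  have hherm : (Complex.I • A).IsHermitian := by
    rw [Matrix.IsHermitian, Matrix.conjTranspose_smul, hA]
    simp
  have hsymm := Matrix.isSymmetric_toEuclideanLin_iff.mpr hherm
  have hss : Module.End.IsFinitelySemisimple (Matrix.toEuclideanLin A) := by
    rw [Module.End.isFinitelySemisimple_iff_isSemisimple]
    have := Module.End.isFinitelySemisimple_iff_isSemisimple.mp hsymm.isFinitelySemisimple
    rw [map_smul] at this
    exact (Module.End.IsSemisimple_smul_iff Complex.I_ne_zero).mp this
  rw [← hss.maxGenEigenspace_eq_eigenspace, LinearMap.finrank_maxGenEigenspace_eq,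
    Matrix.toEuclideanLin_eq_toLin_orthonormal, Matrix.charpoly_toLin]

theorem multiplicity_lower_bound {n : ℕ} (S : Matrix (Fin n) (Fin n) ℤ)
    (hS : IsTournament S) (μ : ℂ) (r : ℕ)
    (hroot : (Matrix.charpoly (S.map (Int.cast : ℤ → ℂ))).IsRoot μ)
    (hmult : (Matrix.charpoly (S.map (Int.cast : ℤ → ℂ))).rootMultiplicity μ = r)
    (hnotunit : ¬(IsIntegral ℤ μ ∧ μ ≠ 0 ∧ IsIntegral ℤ μ⁻¹)) :
    ∀ (m : ℕ) (S' : Matrix (Fin m) (Fin m) ℤ), IsTournament S' → S'.det = 1 →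
      (∃ f : Fin n ↪ Fin m, ∀ i j, S' (f i) (f j) = S i j) →
      n + r ≤ m := by
  rintro m S' - hdet ⟨f, hf⟩
  by_contra! hlt
  refine hnotunit ?_
  have hskew : (S.map (Int.cast : ℤ → ℂ))ᴴ = -S.map (Int.cast : ℤ → ℂ) := by
    ext i j
    have : S j i = -S i j := congrFun (congrFun hS.2.1 i) j
    simp [Matrix.conjTranspose_apply, this]
  have hrank := finrank_eigenspace_toEuclideanLin_of_conjTranspose_eq_neg _ hskew μ
  rw [hmult] at hrank
  set E := Module.End.eigenspace (Matrix.toEuclideanLin (S.map (Int.cast : ℤ → ℂ))) μ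
  let P : Matrix (Fin m) (Fin n) ℂ := Matrix.of fun a j => if a = f j then 1 else 0
  have hP_range (v : Fin n → ℂ) (i : Fin n) : (P *ᵥ v) (f i) = v i := by
    simp [P, Matrix.mulVec, dotProduct]
  have hP_compl (v : Fin n → ℂ) (a : Fin m) (ha : a ∉ Set.range f) : (P *ᵥ v) a = 0 := by
    rw [Matrix.mulVec, dotProduct]
    refine Finset.sum_eq_zero fun j _ => ?_
    have : a ≠ f j := fun h => ha ⟨j, h.symm⟩
    simp [P, this]
  have hmul (a : Fin m) (v : Fin n → ℂ) :
      (S'.map (Int.cast : ℤ → ℂ) *ᵥ (P *ᵥ v)) a = ∑ j, (S' a (f j) : ℂ) * v j := by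
    rw [Matrix.mulVec_mulVec]
    simp [P, Matrix.mulVec, dotProduct, Matrix.mul_apply]
  let L : E →ₗ[ℂ] ({a // a ∉ Set.range f} → ℂ) :=
    LinearMap.funLeft ℂ ℂ (Subtype.val : {a // a ∉ Set.range f} → Fin m) ∘ₗ
      (S'.map (Int.cast : ℤ → ℂ) * P).mulVecLin ∘ₗ
      (WithLp.linearEquiv 2 ℂ (Fin n → ℂ)).toLinearMap ∘ₗ E.subtype
  have hcard : Fintype.card {a // a ∉ Set.range f} = m - n := by
    rw [Fintype.card_subtype_compl, Fintype.card_fin]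
    congr 1
    exact (Fintype.card_congr (Equiv.ofInjective f f.injective).symm).trans (Fintype.card_fin n)
  have hnm : n ≤ m := by simpa using Fintype.card_le_of_embedding f
  have hker : LinearMap.ker L ≠ ⊥ := by
    apply LinearMap.ker_ne_bot_of_finrank_lt
    rw [Module.finrank_fintype_fun_eq_card, hcard, hrank]
    omega
  obtain ⟨⟨v, hvE⟩, hvL, hv0⟩ := Submodule.exists_mem_ne_zero_of_ne_bot hker
  have hv : S.map (Int.cast : ℤ → ℂ) *ᵥ v.ofLp = μ • v.ofLp :=
    congrArg WithLp.ofLp (Module.End.mem_eigenspace_iff.mp hvE)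
  refine isUnit_eigenvalue_of_int_det_eq_one S' hdet (w := P *ᵥ v.ofLp) ?_ ?_
  · intro h0
    refine hv0 (Subtype.ext (PiLp.ext fun i => ?_))
    simpa [hP_range] using congrFun h0 (f i)
  · ext a
    by_cases ha : a ∈ Set.range f
    · obtain ⟨i, rfl⟩ := ha
      rw [hmul, Pi.smul_apply, hP_range]
      simpa [hf, Matrix.mulVec, dotProduct] using congrFun hv i
    · rw [Pi.smul_apply, hP_compl _ _ ha, smul_zero, Matrix.mulVec_mulVec]
      exact congrFun (LinearMap.mem_ker.mp hvL) ⟨a, ha⟩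
end

section
/- Let S be the skew-adjacency matrix of a tournament T on n vertices with n ≥ 4, and suppose S is a skew-conference matrix, i.e., S² = (1 − n)·Iₙ. Then every tournament T' on m vertices that contains T as an induced subtournament and is unimodular satisfies m ≥ n + n/2. (Thus u⁺(T) ≥ n/2 for tournaments whose skew-adjacency matrix is a skew-conference matrix.) -/
open Matrix

/-- A square-zero endomorphism has kernel of dimension at least half that of the space. -/
theorem LinearMap.finrank_le_two_mul_finrank_ker_of_comp_self_eq_zero {K V : Type*} [Field K]
    [AddCommGroup V] [Module K V] [FiniteDimensional K V] (f : V →ₗ[K] V) (hf : f ∘ₗ f = 0) :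
    Module.finrank K V ≤ 2 * Module.finrank K (LinearMap.ker f) := by
  have h := f.finrank_range_add_finrank_ker
  have hle : Module.finrank K (LinearMap.range f) ≤ Module.finrank K (LinearMap.ker f) :=
    Submodule.finrank_mono (LinearMap.range_le_ker_iff.2 hf)
  omega

/-- The nullity of a principal submatrix of an invertible matrix is at most the number of
deleted rows. -/
theorem Matrix.finrank_ker_submatrix_add_card_le {K ι κ : Type*} [Field K] [Fintype ι]
    [DecidableEq ι] [Fintype κ] [DecidableEq κ] {A : Matrix κ κ K} (hA : IsUnit A) (f : ι ↪ κ) :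
    Module.finrank K (LinearMap.ker (A.submatrix f f).mulVecLin) + Fintype.card ι ≤
      Fintype.card κ := by
  classical
  have hcols : Function.Injective (A.submatrix id f).mulVec := by
    rw [Matrix.mulVec_injective_iff]
    exact (Matrix.linearIndependent_cols_iff_isUnit.2 hA).comp f f.injective
  let g := (A.submatrix (Subtype.val : {j // j ∉ Set.range f} → κ) f).mulVecLin.domRestrict
    (LinearMap.ker (A.submatrix f f).mulVecLin)
  have hg : Function.Injective g := by
    rw [injective_iff_map_eq_zero]
    rintro ⟨v, hv⟩ hgv
    refine Subtype.ext (hcols ?_)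
    ext j
    change (A.submatrix id f).mulVec v j = (A.submatrix id f).mulVec 0 j
    rw [Matrix.mulVec_zero]
    by_cases hj : j ∈ Set.range f
    · obtain ⟨i, rfl⟩ := hj
      exact congrFun hv i
    · exact congrFun hgv ⟨j, hj⟩
  have hle := LinearMap.finrank_le_finrank_of_injective hg
  have hcard := Fintype.card_subtype_compl (fun j => j ∈ Set.range f)
  have hrange : Fintype.card {j // j ∈ Set.range f} = Fintype.card ι :=
    Set.card_range_of_injective f.injective
  have hικ := Fintype.card_le_of_embedding f
  rw [Module.finrank_fintype_fun_eq_card] at hle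
  omega

theorem skew_conference_lower_bound {n : ℕ} (hn : 4 ≤ n)
    (S : Matrix (Fin n) (Fin n) ℤ) (hS : IsTournament S)
    (hconf : S * S = ((1 : ℤ) - (n : ℤ)) • (1 : Matrix (Fin n) (Fin n) ℤ)) :
    ∀ (m : ℕ) (S' : Matrix (Fin m) (Fin m) ℤ), IsTournament S' → S'.det = 1 →
      (∃ f : Fin n ↪ Fin m, ∀ i j, S' (f i) (f j) = S i j) →
      n + n / 2 ≤ m := by
  rintro m S' - hdet ⟨f, hf⟩
  obtain ⟨p, hp, hpn⟩ := Nat.exists_prime_and_dvd (show n - 1 ≠ 1 by omega)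
  have : Fact p.Prime := ⟨hp⟩
  let φ := Int.castRingHom (ZMod p)
  have hunit : IsUnit (S'.map φ) := by
    rw [Matrix.isUnit_iff_isUnit_det, ← RingHom.mapMatrix_apply, ← RingHom.map_det, hdet]
    simp
  have hsub : (S'.map φ).submatrix f f = S.map φ := by
    ext i j
    simp [hf]
  have hzero : φ (1 - (n : ℤ)) = 0 := by
    have h := (ZMod.natCast_eq_zero_iff (n - 1) p).2 hpn
    rw [Nat.cast_sub (by omega)] at h
    simp only [φ, map_sub, map_one, map_natCast]
    linear_combination -h
  have hsq : S.map φ * S.map φ = 0 := by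
    rw [← Matrix.map_mul, hconf]
    ext i j
    simp only [Matrix.map_apply, Matrix.smul_apply, smul_eq_mul, map_mul, hzero, zero_mul,
      Matrix.zero_apply]
  have hker := LinearMap.finrank_le_two_mul_finrank_ker_of_comp_self_eq_zero (S.map φ).mulVecLin
    (by rw [← Matrix.mulVecLin_mul, hsq, Matrix.mulVecLin_zero])
  have hle := Matrix.finrank_ker_submatrix_add_card_le hunit f
  rw [hsub] at hle
  simp only [Module.finrank_fintype_fun_eq_card, Fintype.card_fin] at hker hle
  omega
end
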